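/- arXiv:2511.00423 — 4 statements merged into one kernel-verified Lean document; each statement's English description precedes it below -/
import Mathlib

section
/- Let (Ω, F) be a measurable space, let r : Ω → ℝ be measurable with |r(x)| ≤ R_max for all x ∈ Ω (where R_max ≥ 0), and let γ ∈ [0,1). Let (p_t)_{t≥0} and (q_t)_{t≥0} be sequences of probability measures on Ω such that KL(p_t ‖ q_t) ≤ ε for every t ≥ 0, where ε ≥ 0. Then |∑_{t=0}^∞ γ^t (∫ r dp_t − ∫ r dq_t)| ≤ (R_max / (1 − γ)) · √(2ε). -/
open MeasureTheory
open scoped ENNReal NNReal Classical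

/-- Kullback–Leibler divergence `∫ log (dp/dq) dp`, equal to `+∞` if `p` is not
absolutely continuous with respect to `q` (or the log-likelihood ratio is not integrable). -/
noncomputable def klDiv {Ω : Type*} [MeasurableSpace Ω] (p q : Measure Ω) : ℝ≥0∞ :=
  if p ≪ q ∧ Integrable (fun x => Real.log (p.rnDeriv q x).toReal) p then
    ENNReal.ofReal (∫ x, Real.log (p.rnDeriv q x).toReal ∂p)
  else ⊤

/-- Donsker–Varadhan inequality. -/
lemma integral_le_integral_llr_add_log_integral_exp {Ω : Type*} [MeasurableSpace Ω]
    {μ ν : Measure Ω} [IsProbabilityMeasure μ] [IsProbabilityMeasure ν] {f : Ω → ℝ}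
    (hμν : μ ≪ ν) (hllr : Integrable (llr μ ν) μ) (hfμ : Integrable f μ)
    (hfν : Integrable (fun x => Real.exp (f x)) ν) :
    ∫ x, f x ∂μ ≤ ∫ x, llr μ ν x ∂μ + Real.log (∫ x, Real.exp (f x) ∂ν) := by
  have : IsProbabilityMeasure (ν.tilted f) := isProbabilityMeasure_tilted hfν
  have h := InformationTheory.integral_llr_add_sub_measure_univ_nonneg
    (hμν.trans (absolutelyContinuous_tilted hfν))
    (integrable_llr_tilted_right hμν hfμ hllr hfν)
  rw [integral_llr_tilted_right hμν hfμ hfν hllr] at h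
  simp only [probReal_univ] at h
  linarith

/-- Pinsker's inequality, tested against a bounded function. -/
lemma abs_integral_sub_integral_le_of_klDiv_le {Ω : Type*} [MeasurableSpace Ω]
    {μ ν : Measure Ω} [IsProbabilityMeasure μ] [IsProbabilityMeasure ν]
    {r : Ω → ℝ} (hr : Measurable r) {R : ℝ} (hR : 0 ≤ R) (hbound : ∀ x, |r x| ≤ R)
    {ε : ℝ} (hε : 0 ≤ ε) (hKL : klDiv μ ν ≤ ENNReal.ofReal ε) :
    |(∫ x, r x ∂μ) - ∫ x, r x ∂ν| ≤ R * Real.sqrt (2 * ε) := by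
  obtain ⟨⟨hac, hllr⟩, hle⟩ : (μ ≪ ν ∧ Integrable (llr μ ν) μ) ∧ ∫ x, llr μ ν x ∂μ ≤ ε := by
    unfold klDiv at hKL
    split_ifs at hKL with h
    · exact ⟨h, (ENNReal.ofReal_le_ofReal_iff hε).1 hKL⟩
    · simp at hKL
  have hrμ : Integrable r μ :=
    Integrable.of_bound hr.aestronglyMeasurable R (ae_of_all _ hbound)
  have hsub := ProbabilityTheory.hasSubgaussianMGF_of_mem_Icc (μ := ν) hr.aemeasurable
    (ae_of_all _ fun x => Set.mem_Icc.2 (abs_le.1 (hbound x)))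
  have key (s : ℝ) :
      0 ≤ R ^ 2 / 2 * (s * s) + (-((∫ x, r x ∂μ) - ∫ x, r x ∂ν)) * s + ε := by
    have hDV := integral_le_integral_llr_add_log_integral_exp hac hllr
      ((hrμ.sub (integrable_const (∫ x, r x ∂ν))).const_mul s) (hsub.integrable_exp_mul s)
    have hcgf := hsub.cgf_le s
    simp only [ProbabilityTheory.cgf, ProbabilityTheory.mgf] at hcgf
    have hc : (((‖R - -R‖₊ / 2) ^ 2 : ℝ≥0) : ℝ) = R ^ 2 := by
      push_cast
      rw [Real.norm_eq_abs, div_pow, sq_abs]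
      ring
    rw [hc] at hcgf
    simp only [Pi.sub_apply] at hDV
    rw [integral_const_mul, integral_sub hrμ (integrable_const _), integral_const] at hDV
    simp only [probReal_univ, one_smul] at hDV
    linarith
  have hdisc := discrim_le_zero key
  rw [discrim] at hdisc
  refine abs_le_of_sq_le_sq ?_ (by positivity)
  rw [mul_pow, Real.sq_sqrt (by positivity)]
  linarith

/-- **Theorem 1 (Bootstrap Alignment Controls Return Gap).**
If the reward is bounded by `Rmax`, the discount `γ ∈ [0,1)`, and at every timestep the
KL divergence between the timestep marginals `p t` and `q t` is at most `ε`, then the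
discounted return gap is at most `Rmax / (1 - γ) · √(2ε)`. -/
theorem return_gap_bound {Ω : Type*} [MeasurableSpace Ω]
    (r : Ω → ℝ) (hr : Measurable r)
    (Rmax : ℝ) (hRmax : 0 ≤ Rmax) (hbound : ∀ x, |r x| ≤ Rmax)
    (γ : ℝ) (hγ0 : 0 ≤ γ) (hγ1 : γ < 1)
    (ε : ℝ) (hε : 0 ≤ ε)
    (p q : ℕ → Measure Ω)
    (hp : ∀ t, IsProbabilityMeasure (p t)) (hq : ∀ t, IsProbabilityMeasure (q t))
    (hKL : ∀ t, klDiv (p t) (q t) ≤ ENNReal.ofReal ε) :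
    |∑' t : ℕ, γ ^ t * ((∫ x, r x ∂(p t)) - (∫ x, r x ∂(q t)))| ≤
      Rmax / (1 - γ) * Real.sqrt (2 * ε) := by
  have hterm (t : ℕ) : ‖γ ^ t * ((∫ x, r x ∂(p t)) - (∫ x, r x ∂(q t)))‖ ≤
      γ ^ t * (Rmax * Real.sqrt (2 * ε)) := by
    have := hp t
    have := hq t
    rw [Real.norm_eq_abs, abs_mul, abs_of_nonneg (pow_nonneg hγ0 t)]
    exact mul_le_mul_of_nonneg_left
      (abs_integral_sub_integral_le_of_klDiv_le hr hRmax hbound hε (hKL t)) (pow_nonneg hγ0 t)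
  have hsum := tsum_of_norm_bounded
    ((hasSum_geometric_of_lt_one hγ0 hγ1).mul_right (Rmax * Real.sqrt (2 * ε))) hterm
  rw [Real.norm_eq_abs] at hsum
  exact hsum.trans_eq (by ring)
end

section
/- Let μ_β, μ_π ∈ ℝ, σ_β, σ_π > 0, ε ≥ 0, and δ ∈ (0,1), and let N(μ, σ²) denote the Gaussian probability measure on ℝ with mean μ and variance σ². Suppose KL(N(μ_β, σ_β²) ‖ N(μ_π, σ_π²)) ≤ ε. Then, under the product measure N(μ_β, σ_β²) ⊗ N(μ_π, σ_π²), the event {(a, b) : |a − b| ≤ σ_β · √(2 · log(2/δ)) + σ_π · √(2ε) + σ_π · √(2 · log(2/δ))} has probability at least 1 − 2δ. -/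
open MeasureTheory ProbabilityTheory
open scoped ENNReal NNReal Classical

/-- A centred Gaussian variable of variance `v` is sub-Gaussian with parameter `v`. -/
lemma hasSubgaussianMGF_sub_mean_gaussianReal (m : ℝ) (v : ℝ≥0) :
    HasSubgaussianMGF (fun x ↦ x - m) v (gaussianReal m v) := by
  have hmap : (gaussianReal m v).map (fun x ↦ x - m) = gaussianReal 0 v := by
    rw [gaussianReal_map_sub_const, sub_self]
  refine ⟨fun t ↦ ?_, fun t ↦ ?_⟩
  · have h := (integrable_exp_mul_gaussianReal (μ := m) (v := v) t).mul_const (Real.exp (-(t * m)))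
    refine h.congr (Filter.Eventually.of_forall fun x ↦ ?_)
    simp only [← Real.exp_add]
    ring_nf
  · rw [mgf_gaussianReal hmap, zero_mul, zero_add]

/-- Two-sided Gaussian concentration around the mean. -/
lemma gaussianReal_abs_sub_mean_gt_le (m : ℝ) {σ δ : ℝ} {v : ℝ≥0} (hσ : 0 < σ)
    (hv : (v : ℝ) = σ ^ 2) (hδ0 : 0 < δ) (hδ2 : δ ≤ 2) :
    gaussianReal m v {x | σ * Real.sqrt (2 * Real.log (2 / δ)) < |x - m|} ≤ ENNReal.ofReal δ := by
  set r := σ * Real.sqrt (2 * Real.log (2 / δ)) with hr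
  have hlog : 0 ≤ Real.log (2 / δ) := Real.log_nonneg ((one_le_div hδ0).2 hδ2)
  have hr0 : 0 ≤ r := by positivity
  have hexp : Real.exp (-r ^ 2 / (2 * v)) = δ / 2 := by
    have h : -r ^ 2 / (2 * v) = -Real.log (2 / δ) := by
      rw [hr, hv, mul_pow, Real.sq_sqrt (by positivity)]
      field_simp
    rw [h, ← Real.log_inv, Real.exp_log (by positivity), inv_div]
  have hX := hasSubgaussianMGF_sub_mean_gaussianReal m v
  have h1 := hX.measure_ge_le hr0
  have h2 := hX.neg.measure_ge_le hr0
  rw [hexp] at h1 h2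
  have hsub : {x | r < |x - m|} ⊆ {x | r ≤ x - m} ∪ {x | r ≤ (-fun x ↦ x - m) x} := by
    intro x hx
    rw [Set.mem_ofPred_eq] at hx
    rcases lt_abs.1 hx with h | h
    · exact Or.inl h.le
    · exact Or.inr h.le
  refine ENNReal.le_ofReal_iff_toReal_le (measure_ne_top _ _) hδ0.le |>.2 ?_
  calc (gaussianReal m v).real {x | r < |x - m|}
      ≤ (gaussianReal m v).real ({x | r ≤ x - m} ∪ {x | r ≤ (-fun x ↦ x - m) x}) :=
        measureReal_mono hsub
    _ ≤ _ := measureReal_union_le _ _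
    _ ≤ δ := by linarith

/-- The log-density ratio of two nondegenerate Gaussians. -/
lemma log_rnDeriv_gaussianReal_ae_eq (m₁ m₂ : ℝ) {v₁ v₂ : ℝ≥0} (h₁ : v₁ ≠ 0) (h₂ : v₂ ≠ 0) :
    (fun x ↦ Real.log ((gaussianReal m₁ v₁).rnDeriv (gaussianReal m₂ v₂) x).toReal)
      =ᵐ[gaussianReal m₁ v₁] fun x ↦
        -(Real.log (v₁ / v₂) / 2) - (x - m₁) ^ 2 / (2 * v₁) + (x - m₂) ^ 2 / (2 * v₂) := by
  have hv₁ : (0 : ℝ) < v₁ := by positivity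
  have hv₂ : (0 : ℝ) < v₂ := by positivity
  have hdiv : (gaussianReal m₁ v₁).rnDeriv (gaussianReal m₂ v₂) =ᵐ[volume]
      fun x ↦ ((gaussianReal m₂ v₂).rnDeriv volume x)⁻¹ * (gaussianReal m₁ v₁).rnDeriv volume x := by
    have h := Measure.rnDeriv_mul_rnDeriv (κ := volume)
      ((gaussianReal_absolutelyContinuous m₁ h₁).trans
        (gaussianReal_absolutelyContinuous' m₂ h₂))
    filter_upwards [h, rnDeriv_gaussianReal m₂ v₂] with x hx hx₂
    rw [← hx, Pi.mul_apply, hx₂, mul_comm, mul_assoc,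
      ENNReal.mul_inv_cancel (gaussianPDF_pos m₂ h₂ x).ne' gaussianPDF_ne_top, mul_one]
  refine (gaussianReal_absolutelyContinuous m₁ h₁).ae_le ?_
  filter_upwards [hdiv, rnDeriv_gaussianReal m₁ v₁, rnDeriv_gaussianReal m₂ v₂] with x hx hx₁ hx₂
  rw [hx, hx₁, hx₂, ENNReal.toReal_mul, ENNReal.toReal_inv, toReal_gaussianPDF,
    toReal_gaussianPDF, Real.log_mul (inv_ne_zero (gaussianPDFReal_pos _ _ _ h₂).ne')
      (gaussianPDFReal_pos _ _ _ h₁).ne', Real.log_inv]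
  simp only [gaussianPDFReal]
  have hs₁ : (√(2 * Real.pi * v₁))⁻¹ ≠ 0 := by positivity
  have hs₂ : (√(2 * Real.pi * v₂))⁻¹ ≠ 0 := by positivity
  rw [Real.log_mul hs₁ (Real.exp_ne_zero _), Real.log_mul hs₂ (Real.exp_ne_zero _),
    Real.log_exp, Real.log_exp, Real.log_inv, Real.log_inv, Real.log_sqrt (by positivity),
    Real.log_sqrt (by positivity), Real.log_mul (by positivity) hv₁.ne',
    Real.log_mul (by positivity) hv₂.ne', Real.log_div hv₁.ne' hv₂.ne']
  ring

/-- The second moment of a Gaussian about an arbitrary point. -/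
lemma integral_sq_sub_gaussianReal (m c : ℝ) (v : ℝ≥0) :
    Integrable (fun x ↦ (x - c) ^ 2) (gaussianReal m v) ∧
      ∫ x, (x - c) ^ 2 ∂gaussianReal m v = v + (m - c) ^ 2 := by
  have hmem : MemLp (fun x ↦ x - c) 2 (gaussianReal m v) :=
    (memLp_id_gaussianReal 2).sub (memLp_const c)
  have hid : Integrable (fun x ↦ x) (gaussianReal m v) :=
    (memLp_id_gaussianReal 1).integrable (by simp)
  have hvar := variance_eq_sub hmem
  have hmean : ∫ x, (x - c) ∂gaussianReal m v = m - c := by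
    rw [integral_sub hid (integrable_const c)]
    simp
  rw [variance_sub_const hid.aestronglyMeasurable, variance_fun_id_gaussianReal, hmean] at hvar
  refine ⟨hmem.integrable_sq, ?_⟩
  simp only [Pi.pow_apply] at hvar
  linarith

/-- Closed form of the expected log-likelihood ratio of two Gaussians. -/
lemma integral_log_rnDeriv_gaussianReal (m₁ m₂ : ℝ) {v₁ v₂ : ℝ≥0} (h₁ : v₁ ≠ 0) (h₂ : v₂ ≠ 0) :
    ∫ x, Real.log ((gaussianReal m₁ v₁).rnDeriv (gaussianReal m₂ v₂) x).toReal
        ∂gaussianReal m₁ v₁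
      = (v₁ / v₂ - 1 - Real.log (v₁ / v₂)) / 2 + (m₁ - m₂) ^ 2 / (2 * v₂) := by
  obtain ⟨hi₁, he₁⟩ := integral_sq_sub_gaussianReal m₁ m₁ v₁
  obtain ⟨hi₂, he₂⟩ := integral_sq_sub_gaussianReal m₁ m₂ v₁
  have hv₁ : (v₁ : ℝ) ≠ 0 := by exact_mod_cast h₁
  have hv₂ : (v₂ : ℝ) ≠ 0 := by exact_mod_cast h₂
  rw [integral_congr_ae (log_rnDeriv_gaussianReal_ae_eq m₁ m₂ h₁ h₂),
    integral_add (f := fun x ↦ -(Real.log (v₁ / v₂) / 2) - (x - m₁) ^ 2 / (2 * v₁))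
      ((integrable_const _).sub (hi₁.div_const _)) (hi₂.div_const _),
    integral_sub (integrable_const _) (hi₁.div_const _), integral_div, integral_div, he₁, he₂,
    integral_const, probReal_univ]
  simp only [smul_eq_mul]
  field_simp
  ring

/-- The Kullback–Leibler divergence controls the distance between Gaussian means. -/
lemma abs_sub_mean_le_of_klDiv_gaussianReal_le {m₁ m₂ σ ε : ℝ} {v₁ v₂ : ℝ≥0} (h₁ : v₁ ≠ 0)
    (hσ : 0 < σ) (hv₂ : (v₂ : ℝ) = σ ^ 2) (hε : 0 ≤ ε)
    (hKL : klDiv (gaussianReal m₁ v₁) (gaussianReal m₂ v₂) ≤ ENNReal.ofReal ε) :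
    |m₁ - m₂| ≤ σ * Real.sqrt (2 * ε) := by
  have h₂ : v₂ ≠ 0 := by
    rintro rfl
    exact (pow_pos hσ 2).ne hv₂
  unfold klDiv at hKL
  split_ifs at hKL
  · rw [ENNReal.ofReal_le_ofReal_iff hε, integral_log_rnDeriv_gaussianReal m₁ m₂ h₁ h₂] at hKL
    have hlog := Real.log_le_sub_one_of_pos (x := (v₁ : ℝ) / v₂) (by positivity)
    have hle : (m₁ - m₂) ^ 2 / (2 * v₂) ≤ ε := by linarith
    rw [hv₂, div_le_iff₀ (by positivity)] at hle
    refine abs_le_of_sq_le_sq ?_ (by positivity)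
    rw [mul_pow, Real.sq_sqrt (by positivity)]
    linarith
  · exact absurd hKL (by simp)

/-- Deviation bound for independent Gaussians whose Kullback–Leibler divergence is bounded. -/
lemma ofReal_le_prod_gaussianReal_abs_sub_le {μβ μπ σβ σπ ε δ : ℝ} {vβ vπ : ℝ≥0}
    (hσβ : 0 < σβ) (hσπ : 0 < σπ) (hvβ : (vβ : ℝ) = σβ ^ 2) (hvπ : (vπ : ℝ) = σπ ^ 2)
    (hε : 0 ≤ ε) (hδ0 : 0 < δ) (hδ2 : δ ≤ 2)
    (hKL : klDiv (gaussianReal μβ vβ) (gaussianReal μπ vπ) ≤ ENNReal.ofReal ε) :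
    ENNReal.ofReal (1 - 2 * δ) ≤ ((gaussianReal μβ vβ).prod (gaussianReal μπ vπ))
      {ab : ℝ × ℝ | |ab.1 - ab.2| ≤ σβ * Real.sqrt (2 * Real.log (2 / δ)) +
        σπ * Real.sqrt (2 * ε) + σπ * Real.sqrt (2 * Real.log (2 / δ))} := by
  have hβ : vβ ≠ 0 := by
    rintro rfl
    exact (pow_pos hσβ 2).ne hvβ
  have hmean := abs_sub_mean_le_of_klDiv_gaussianReal_le hβ hσπ hvπ hε hKL
  have hA := gaussianReal_abs_sub_mean_gt_le μβ hσβ hvβ hδ0 hδ2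
  have hB := gaussianReal_abs_sub_mean_gt_le μπ hσπ hvπ hδ0 hδ2
  set P := gaussianReal μβ vβ
  set Q := gaussianReal μπ vπ
  set A := {x | σβ * Real.sqrt (2 * Real.log (2 / δ)) < |x - μβ|}
  set B := {x | σπ * Real.sqrt (2 * Real.log (2 / δ)) < |x - μπ|}
  set S := {ab : ℝ × ℝ | |ab.1 - ab.2| ≤ σβ * Real.sqrt (2 * Real.log (2 / δ)) +
    σπ * Real.sqrt (2 * ε) + σπ * Real.sqrt (2 * Real.log (2 / δ))} with hS
  have hcover : Set.univ ⊆ S ∪ (A ×ˢ Set.univ ∪ Set.univ ×ˢ B) := by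
    rintro ⟨a, b⟩ -
    by_cases ha : a ∈ A
    · exact Or.inr (Or.inl ⟨ha, trivial⟩)
    by_cases hb : b ∈ B
    · exact Or.inr (Or.inr ⟨trivial, hb⟩)
    refine Or.inl ?_
    have ha' : |a - μβ| ≤ _ := not_lt.1 (Set.notMem_ofPred_iff.1 ha)
    have hb' : |b - μπ| ≤ _ := not_lt.1 (Set.notMem_ofPred_iff.1 hb)
    have h₁ := abs_sub_le a μβ b
    have h₂ := abs_sub_le μβ μπ b
    rw [abs_sub_comm μπ b] at h₂
    simp only [hS, Set.mem_ofPred_eq]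
    linarith
  have hone : 1 ≤ (P.prod Q) S + ENNReal.ofReal (2 * δ) := by
    calc 1 = (P.prod Q) Set.univ := measure_univ.symm
      _ ≤ (P.prod Q) S + ((P.prod Q) (A ×ˢ Set.univ) + (P.prod Q) (Set.univ ×ˢ B)) :=
        (measure_mono hcover).trans ((measure_union_le _ _).trans
          (add_le_add le_rfl (measure_union_le _ _)))
      _ ≤ (P.prod Q) S + (ENNReal.ofReal δ + ENNReal.ofReal δ) := by
        simp only [Measure.prod_prod, measure_univ, mul_one, one_mul]
        gcongr
      _ = (P.prod Q) S + ENNReal.ofReal (2 * δ) := by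
        rw [← ENNReal.ofReal_add hδ0.le hδ0.le, two_mul]
  rw [ENNReal.ofReal_sub _ (by positivity), ENNReal.ofReal_one]
  exact tsub_le_iff_right.2 hone

/-- **Theorem 2, deviation bound `D(ε)` (one-dimensional, single-component case).**
If `KL(N(μ_β, σ_β²) ‖ N(μ_π, σ_π²)) ≤ ε`, then independent samples `a ~ N(μ_β, σ_β²)`
and `b ~ N(μ_π, σ_π²)` satisfy
`|a - b| ≤ σ_β √(2 log(2/δ)) + σ_π √(2ε) + σ_π √(2 log(2/δ))`
with probability at least `1 - 2δ`. -/
theorem action_deviation_bound {μβ μπ σβ σπ ε δ : ℝ}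
    (hσβ : 0 < σβ) (hσπ : 0 < σπ) (hε : 0 ≤ ε) (hδ0 : 0 < δ) (hδ1 : δ < 1)
    (hKL : klDiv (gaussianReal μβ ⟨σβ ^ 2, sq_nonneg σβ⟩)
        (gaussianReal μπ ⟨σπ ^ 2, sq_nonneg σπ⟩) ≤ ENNReal.ofReal ε) :
    ENNReal.ofReal (1 - 2 * δ) ≤
      ((gaussianReal μβ ⟨σβ ^ 2, sq_nonneg σβ⟩).prod
          (gaussianReal μπ ⟨σπ ^ 2, sq_nonneg σπ⟩))
        {ab : ℝ × ℝ |
          |ab.1 - ab.2| ≤ σβ * Real.sqrt (2 * Real.log (2 / δ)) +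
            σπ * Real.sqrt (2 * ε) + σπ * Real.sqrt (2 * Real.log (2 / δ))} := by
  exact ofReal_le_prod_gaussianReal_abs_sub_le hσβ hσπ rfl rfl hε hδ0 (by linarith) hKL
end

section
/- Let μ_β, μ_π ∈ ℝ, σ_β, σ_π > 0, ε ≥ 0, δ ∈ (0,1), and let Q : ℝ → ℝ be L-Lipschitz with L ≥ 0. Let N(μ, σ²) denote the Gaussian probability measure on ℝ with mean μ and variance σ², and suppose KL(N(μ_β, σ_β²) ‖ N(μ_π, σ_π²)) ≤ ε. Then, under the product measure N(μ_β, σ_β²) ⊗ N(μ_π, σ_π²), the event {(a, b) : |Q(a) − Q(b)| ≤ L · (σ_β · √(2 · log(2/δ)) + σ_π · √(2ε) + σ_π · √(2 · log(2/δ)))} has probability at least 1 − 2δ. -/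
open MeasureTheory ProbabilityTheory
open scoped ENNReal NNReal Classical

namespace ProbabilityTheory

lemma hasSubgaussianMGF_sub_mean_gaussianReal (μ : ℝ) (v : ℝ≥0) :
    HasSubgaussianMGF (fun x ↦ x - μ) v (gaussianReal μ v) where
  integrable_exp_mul t := by
    have h := (integrable_exp_mul_gaussianReal (μ := μ) (v := v) t).mul_const (Real.exp (-(t * μ)))
    refine h.congr (.of_forall fun x ↦ ?_)
    simp only [← Real.exp_add]
    ring_nf
  mgf_le t := by
    rw [mgf_gaussianReal (gaussianReal_map_sub_const μ)]
    simp

lemma gaussianReal_real_abs_sub_mean_ge_le (μ : ℝ) (v : ℝ≥0) {r : ℝ} (hr : 0 ≤ r) :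
    (gaussianReal μ v).real {x | r ≤ |x - μ|} ≤ 2 * Real.exp (-r ^ 2 / (2 * v)) := by
  have h := hasSubgaussianMGF_sub_mean_gaussianReal μ v
  have hsub : {x | r ≤ |x - μ|} ⊆ {x | r ≤ x - μ} ∪ {x | r ≤ (-fun x ↦ x - μ) x} :=
    fun x (hx : r ≤ |x - μ|) ↦ le_abs.1 hx
  calc (gaussianReal μ v).real {x | r ≤ |x - μ|}
      ≤ (gaussianReal μ v).real ({x | r ≤ x - μ} ∪ {x | r ≤ (-fun x ↦ x - μ) x}) :=
        measureReal_mono hsub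
    _ ≤ _ := measureReal_union_le _ _
    _ ≤ 2 * Real.exp (-r ^ 2 / (2 * v)) := by
        linarith [h.measure_ge_le hr, h.neg.measure_ge_le hr]

/-- A Gaussian variable with standard deviation `σ` is within `σ √(2 log (2 / δ))` of its mean
with probability at least `1 - δ`. -/
lemma le_gaussianReal_abs_sub_mean_le (μ : ℝ) {σ δ : ℝ} {v : ℝ≥0} (hσ : 0 < σ) (hv : (v : ℝ) = σ ^ 2)
    (hδ0 : 0 < δ) (hδ1 : δ < 1) :
    ENNReal.ofReal (1 - δ) ≤ gaussianReal μ v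
      {x | |x - μ| ≤ σ * Real.sqrt (2 * Real.log (2 / δ))} := by
  set P := gaussianReal μ v
  set r := σ * Real.sqrt (2 * Real.log (2 / δ)) with hr
  have hlog : 0 ≤ Real.log (2 / δ) := Real.log_nonneg (by rw [le_div_iff₀ hδ0]; linarith)
  have htail : P.real {x | r ≤ |x - μ|} ≤ δ := by
    refine (gaussianReal_real_abs_sub_mean_ge_le μ _ (by positivity)).trans_eq ?_
    have : -r ^ 2 / (2 * σ ^ 2) = -Real.log (2 / δ) := by
      rw [hr, mul_pow, Real.sq_sqrt (by positivity)]
      field_simp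
    rw [hv, this, Real.exp_neg, Real.exp_log (by positivity)]
    field_simp
  have hmeas : MeasurableSet {x : ℝ | |x - μ| ≤ r} :=
    measurableSet_le (by fun_prop) measurable_const
  have hcompl : P.real {x | |x - μ| ≤ r}ᶜ ≤ δ :=
    (measureReal_mono (s₂ := {x | r ≤ |x - μ|})
      fun x (hx : ¬ |x - μ| ≤ r) ↦ (not_le.1 hx).le).trans htail
  rw [probReal_compl_eq_one_sub hmeas] at hcompl
  rw [ENNReal.ofReal_le_iff_le_toReal (measure_ne_top _ _)]
  change _ ≤ P.real _
  linarith

lemma integrable_sub_sq_gaussianReal (μ m : ℝ) (v : ℝ≥0) :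
    Integrable (fun x ↦ (x - m) ^ 2) (gaussianReal μ v) :=
  ((memLp_id_gaussianReal 2).sub (memLp_const m)).integrable_sq

lemma integral_sub_sq_gaussianReal (μ m : ℝ) (v : ℝ≥0) :
    ∫ x, (x - m) ^ 2 ∂gaussianReal μ v = v + (μ - m) ^ 2 := by
  have hvar : ∫ x, (x - μ) ^ 2 ∂gaussianReal μ v = v := by
    have h := variance_fun_id_gaussianReal (μ := μ) (v := v)
    rwa [variance_eq_integral measurable_id'.aemeasurable, integral_id_gaussianReal] at h
  have hint : Integrable (fun x : ℝ ↦ x) (gaussianReal μ v) :=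
    (memLp_id_gaussianReal 1).integrable (by simp)
  have hsplit : (fun x : ℝ ↦ (x - m) ^ 2) =
      fun x ↦ (x - μ) ^ 2 + (2 * (μ - m) * x + ((μ - m) ^ 2 - 2 * (μ - m) * μ)) := by
    ext x; ring
  have hlin : Integrable (fun x ↦ 2 * (μ - m) * x + ((μ - m) ^ 2 - 2 * (μ - m) * μ))
      (gaussianReal μ v) := (hint.const_mul _).add (integrable_const _)
  rw [hsplit, integral_add (integrable_sub_sq_gaussianReal μ μ v) hlin,
    integral_add (hint.const_mul _) (integrable_const _), integral_const_mul,
    integral_id_gaussianReal, hvar]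
  simp

lemma log_gaussianPDFReal (μ : ℝ) {v : ℝ≥0} (hv : v ≠ 0) (x : ℝ) :
    Real.log (gaussianPDFReal μ v x) =
      -(Real.log (2 * Real.pi) + Real.log v) / 2 - (x - μ) ^ 2 / (2 * v) := by
  have hv' : 0 < (v : ℝ) := by positivity
  rw [gaussianPDFReal_def, Real.log_mul (by positivity) (by positivity), Real.log_exp,
    Real.log_inv, Real.log_sqrt (by positivity), Real.log_mul (by positivity) (by positivity)]
  ring

lemma log_rnDeriv_gaussianReal_gaussianReal (μ₁ μ₂ : ℝ) {v₁ v₂ : ℝ≥0} (h₁ : v₁ ≠ 0)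
    (h₂ : v₂ ≠ 0) :
    (fun x ↦ Real.log ((gaussianReal μ₁ v₁).rnDeriv (gaussianReal μ₂ v₂) x).toReal)
      =ᵐ[gaussianReal μ₁ v₁]
    fun x ↦ (x - μ₂) ^ 2 / (2 * v₂) - (x - μ₁) ^ 2 / (2 * v₁) +
      (Real.log v₂ - Real.log v₁) / 2 := by
  have hac : gaussianReal μ₁ v₁ ≪ volume := gaussianReal_absolutelyContinuous μ₁ h₁
  have hchain := Measure.rnDeriv_mul_rnDeriv (κ := volume)
    (hac.trans (gaussianReal_absolutelyContinuous' μ₂ h₂))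
  filter_upwards [hac hchain, hac (rnDeriv_gaussianReal μ₁ v₁), hac (rnDeriv_gaussianReal μ₂ v₂)]
    with x hx hx₁ hx₂
  rw [Pi.mul_apply, hx₁, hx₂] at hx
  have hreal := congrArg ENNReal.toReal hx
  rw [ENNReal.toReal_mul, toReal_gaussianPDF, toReal_gaussianPDF] at hreal
  have hp₂ := gaussianPDFReal_pos μ₂ v₂ x h₂
  rw [eq_div_of_mul_eq hp₂.ne' hreal, Real.log_div (gaussianPDFReal_pos μ₁ v₁ x h₁).ne' hp₂.ne',
    log_gaussianPDFReal μ₁ h₁, log_gaussianPDFReal μ₂ h₂]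
  ring

lemma integral_log_rnDeriv_gaussianReal_gaussianReal (μ₁ μ₂ : ℝ) {v₁ v₂ : ℝ≥0} (h₁ : v₁ ≠ 0)
    (h₂ : v₂ ≠ 0) :
    ∫ x, Real.log ((gaussianReal μ₁ v₁).rnDeriv (gaussianReal μ₂ v₂) x).toReal
        ∂gaussianReal μ₁ v₁ =
      (v₁ + (μ₁ - μ₂) ^ 2) / (2 * v₂) - 1 / 2 + (Real.log v₂ - Real.log v₁) / 2 := by
  have hv₁ : (v₁ : ℝ) ≠ 0 := by exact_mod_cast h₁
  have hi₁ := (integrable_sub_sq_gaussianReal μ₁ μ₁ v₁).div_const (2 * v₁)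
  have hi₂ := (integrable_sub_sq_gaussianReal μ₁ μ₂ v₁).div_const (2 * v₂)
  rw [integral_congr_ae (log_rnDeriv_gaussianReal_gaussianReal μ₁ μ₂ h₁ h₂),
    integral_add (f := fun x ↦ (x - μ₂) ^ 2 / (2 * v₂) - (x - μ₁) ^ 2 / (2 * v₁))
      (hi₂.sub hi₁) (integrable_const _), integral_sub hi₂ hi₁, integral_div,
    integral_div, integral_sub_sq_gaussianReal, integral_sub_sq_gaussianReal]
  simp
  field_simp

/-- The distance of the means of two Gaussians is controlled by their relative entropy. -/
lemma sq_sub_le_of_klDiv_gaussianReal_le {μ₁ μ₂ ε : ℝ} {v₁ v₂ : ℝ≥0} (h₁ : v₁ ≠ 0)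
    (h₂ : v₂ ≠ 0) (hε : 0 ≤ ε)
    (hKL : klDiv (gaussianReal μ₁ v₁) (gaussianReal μ₂ v₂) ≤ ENNReal.ofReal ε) :
    (μ₁ - μ₂) ^ 2 ≤ v₂ * (2 * ε) := by
  unfold klDiv at hKL
  split_ifs at hKL with h
  · rw [ENNReal.ofReal_le_ofReal_iff hε,
      integral_log_rnDeriv_gaussianReal_gaussianReal μ₁ μ₂ h₁ h₂] at hKL
    have hv₁ : 0 < (v₁ : ℝ) := by positivity
    have hv₂ : 0 < (v₂ : ℝ) := by positivity
    have hlog := Real.log_le_sub_one_of_pos (div_pos hv₁ hv₂)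
    rw [Real.log_div hv₁.ne' hv₂.ne'] at hlog
    have hsplit : (v₁ + (μ₁ - μ₂) ^ 2) / (2 * v₂) =
        (v₁ / v₂ : ℝ) / 2 + (μ₁ - μ₂) ^ 2 / (2 * v₂) := by
      field_simp
    have hmain : (μ₁ - μ₂) ^ 2 / (2 * v₂) ≤ ε := by linarith
    rw [div_le_iff₀ (by positivity)] at hmain
    linarith
  · exact absurd hKL (by simp)

/-- The bound of `q_value_gap_bound` for Gaussians parametrized by their variances. -/
lemma le_gaussianReal_prod_abs_sub_le {μβ μπ σβ σπ ε δ L : ℝ} {vβ vπ : ℝ≥0} {Q : ℝ → ℝ}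
    (hσβ : 0 < σβ) (hσπ : 0 < σπ) (hvβ : (vβ : ℝ) = σβ ^ 2) (hvπ : (vπ : ℝ) = σπ ^ 2)
    (hε : 0 ≤ ε) (hδ0 : 0 < δ) (hδ1 : δ < 1)
    (hL : 0 ≤ L) (hLip : ∀ x y, |Q x - Q y| ≤ L * |x - y|)
    (hKL : klDiv (gaussianReal μβ vβ) (gaussianReal μπ vπ) ≤ ENNReal.ofReal ε) :
    ENNReal.ofReal (1 - 2 * δ) ≤ ((gaussianReal μβ vβ).prod (gaussianReal μπ vπ))
      {ab : ℝ × ℝ |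
        |Q ab.1 - Q ab.2| ≤ L * (σβ * Real.sqrt (2 * Real.log (2 / δ)) +
          σπ * Real.sqrt (2 * ε) + σπ * Real.sqrt (2 * Real.log (2 / δ)))} := by
  have hβ0 : vβ ≠ 0 := by
    rw [← NNReal.coe_ne_zero, hvβ]
    positivity
  have hπ0 : vπ ≠ 0 := by
    rw [← NNReal.coe_ne_zero, hvπ]
    positivity
  have hmean : |μβ - μπ| ≤ σπ * Real.sqrt (2 * ε) := by
    have hsq := sq_sub_le_of_klDiv_gaussianReal_le hβ0 hπ0 hε hKL
    rw [hvπ] at hsq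
    refine abs_le_of_sq_le_sq ?_ (by positivity)
    rwa [mul_pow, Real.sq_sqrt (by positivity)]
  have hβ := le_gaussianReal_abs_sub_mean_le μβ hσβ hvβ hδ0 hδ1
  have hπ := le_gaussianReal_abs_sub_mean_le μπ hσπ hvπ hδ0 hδ1
  set tβ := σβ * Real.sqrt (2 * Real.log (2 / δ))
  set tπ := σπ * Real.sqrt (2 * Real.log (2 / δ))
  have hsub : {a | |a - μβ| ≤ tβ} ×ˢ {b | |b - μπ| ≤ tπ} ⊆
      {ab : ℝ × ℝ | |Q ab.1 - Q ab.2| ≤ L * (tβ + σπ * Real.sqrt (2 * ε) + tπ)} := by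
    rintro ⟨a, b⟩ ⟨ha, hb⟩
    refine (hLip a b).trans (mul_le_mul_of_nonneg_left ?_ hL)
    have ha' : |a - μβ| ≤ tβ := ha
    have hb' : |b - μπ| ≤ tπ := hb
    rw [abs_le] at ha' hb' hmean ⊢
    constructor <;> linarith
  calc ENNReal.ofReal (1 - 2 * δ)
      ≤ ENNReal.ofReal ((1 - δ) * (1 - δ)) :=
        ENNReal.ofReal_le_ofReal (by nlinarith [sq_nonneg δ])
    _ = ENNReal.ofReal (1 - δ) * ENNReal.ofReal (1 - δ) := ENNReal.ofReal_mul (by linarith)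
    _ ≤ _ := mul_le_mul' hβ hπ
    _ = _ := (Measure.prod_prod _ _).symm
    _ ≤ _ := measure_mono hsub

end ProbabilityTheory

/-- **Theorem 2 (Bootstrap Alignment Controls Q-Value Gap), one-dimensional,
single-component case.** If `Q` is `L`-Lipschitz and
`KL(N(μ_β, σ_β²) ‖ N(μ_π, σ_π²)) ≤ ε`, then for independent samples
`a ~ N(μ_β, σ_β²)` and `b ~ N(μ_π, σ_π²)`,
`|Q a - Q b| ≤ L (σ_β √(2 log(2/δ)) + σ_π √(2ε) + σ_π √(2 log(2/δ)))`
with probability at least `1 - 2δ`. -/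
theorem q_value_gap_bound {μβ μπ σβ σπ ε δ L : ℝ} (Q : ℝ → ℝ)
    (hσβ : 0 < σβ) (hσπ : 0 < σπ) (hε : 0 ≤ ε) (hδ0 : 0 < δ) (hδ1 : δ < 1)
    (hL : 0 ≤ L) (hLip : ∀ x y, |Q x - Q y| ≤ L * |x - y|)
    (hKL : klDiv (gaussianReal μβ ⟨σβ ^ 2, sq_nonneg σβ⟩)
        (gaussianReal μπ ⟨σπ ^ 2, sq_nonneg σπ⟩) ≤ ENNReal.ofReal ε) :
    ENNReal.ofReal (1 - 2 * δ) ≤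
      ((gaussianReal μβ ⟨σβ ^ 2, sq_nonneg σβ⟩).prod
          (gaussianReal μπ ⟨σπ ^ 2, sq_nonneg σπ⟩))
        {ab : ℝ × ℝ |
          |Q ab.1 - Q ab.2| ≤ L * (σβ * Real.sqrt (2 * Real.log (2 / δ)) +
            σπ * Real.sqrt (2 * ε) + σπ * Real.sqrt (2 * Real.log (2 / δ)))} := by
  exact le_gaussianReal_prod_abs_sub_le hσβ hσπ rfl rfl hε hδ0 hδ1 hL hLip hKL
end

section
/- Let d ≥ 1 and let P be the product probability measure on ℝ^d whose coordinates are independent standard Gaussians N(0,1). Then for every x ≥ 0, P({z ∈ ℝ^d : ∑_{i=1}^d z_i² ≥ d + 2·√(d·x) + 2·x}) ≤ exp(−x). -/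
open MeasureTheory ProbabilityTheory
open scoped ENNReal NNReal

/-- The exponential of `t z²` integrates against the standard Gaussian for `t < 1 / 2`. -/
lemma integrable_exp_mul_sq_gaussianReal {t : ℝ} (ht : t < 1 / 2) :
    Integrable (fun z => Real.exp (t * z ^ 2)) (gaussianReal 0 1) := by
  rw [gaussianReal_of_var_ne_zero _ one_ne_zero,
    integrable_withDensity_iff_integrable_smul' (measurable_gaussianPDF _ _)
      (ae_of_all _ fun _ => gaussianPDF_lt_top)]
  refine ((integrable_exp_neg_mul_sq (b := 1 / 2 - t) (by linarith)).const_mul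
    (√(2 * Real.pi))⁻¹).congr (ae_of_all _ fun z => ?_)
  simp only [toReal_gaussianPDF, gaussianPDFReal, NNReal.coe_one, mul_one, sub_zero, smul_eq_mul,
    mul_assoc, ← Real.exp_add]
  congr 2
  ring

/-- The moment generating function of the chi-squared distribution with one degree of freedom. -/
lemma integral_exp_mul_sq_gaussianReal {t : ℝ} (ht : t < 1 / 2) :
    ∫ z, Real.exp (t * z ^ 2) ∂(gaussianReal 0 1) = √(1 - 2 * t)⁻¹ := by
  have h (z : ℝ) : gaussianPDFReal 0 1 z • Real.exp (t * z ^ 2) =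
      (√(2 * Real.pi))⁻¹ * Real.exp (-(1 / 2 - t) * z ^ 2) := by
    simp only [gaussianPDFReal, NNReal.coe_one, mul_one, sub_zero, smul_eq_mul,
      mul_assoc, ← Real.exp_add]
    congr 2
    ring
  simp_rw [integral_gaussianReal_eq_integral_smul one_ne_zero, h]
  rw [integral_const_mul, integral_gaussian, ← Real.sqrt_inv, ← Real.sqrt_mul (by positivity)]
  congr 1
  have : 1 - 2 * t ≠ 0 := by linarith
  have : 1 / 2 - t ≠ 0 := by linarith
  field_simp

lemma sqrt_le_exp_sub_inv_div_four {y : ℝ} (hy : 1 ≤ y) :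
    √y ≤ Real.exp ((y - y⁻¹) / 4) := by
  have hy0 : 0 < y := by linarith
  have h := Real.self_le_sinh_iff.2 (Real.log_nonneg hy)
  rw [Real.sinh_log hy0] at h
  rw [Real.sqrt_le_left (Real.exp_pos _).le, ← Real.exp_nat_mul, ← Real.log_le_iff_le_exp hy0]
  push_cast
  linarith

/-- Chernoff bound for the chi-squared distribution. -/
lemma pi_gaussianReal_real_le_sum_sq_le_exp {d : ℕ} {t : ℝ} (ht0 : 0 ≤ t) (ht : t < 1 / 2)
    (ε : ℝ) :
    (Measure.pi (fun _ : Fin d => gaussianReal 0 1)).real {z | ε ≤ ∑ i, z i ^ 2} ≤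
      Real.exp (-t * ε + d * (((1 - 2 * t)⁻¹ - (1 - 2 * t)) / 4)) := by
  have hexp (z : Fin d → ℝ) :
      Real.exp (t * ∑ i, z i ^ 2) = ∏ i, Real.exp (t * z i ^ 2) := by
    rw [Finset.mul_sum, Real.exp_sum]
  refine (measure_ge_le_exp_mul_mgf (X := fun z : Fin d → ℝ => ∑ i, z i ^ 2) ε ht0 ?_).trans ?_
  · simp_rw [hexp]
    exact Integrable.fintype_prod fun _ => integrable_exp_mul_sq_gaussianReal ht
  · rw [mgf]
    simp_rw [hexp]
    rw [integral_fintype_prod_eq_pow (fun z : ℝ => Real.exp (t * z ^ 2)),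
      integral_exp_mul_sq_gaussianReal ht, Fintype.card_fin, Real.exp_add, Real.exp_nat_mul]
    gcongr
    simpa using sqrt_le_exp_sub_inv_div_four
      ((one_le_inv₀ (by linarith : 0 < 1 - 2 * t)).2 (by linarith))

/-- **Laurent–Massart concentration inequality for chi-squared variables.**
For `z` with `d` independent standard Gaussian coordinates,
`P(∑ z_i² ≥ d + 2√(d x) + 2x) ≤ exp(-x)` for every `x ≥ 0`. -/
theorem laurent_massart_chi_squared {d : ℕ} (hd : 1 ≤ d) (x : ℝ) (hx : 0 ≤ x) :
    Measure.pi (fun _ : Fin d => gaussianReal 0 1)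
        {z : Fin d → ℝ |
          (d : ℝ) + 2 * Real.sqrt (d * x) + 2 * x ≤ ∑ i : Fin d, z i ^ 2} ≤
      ENNReal.ofReal (Real.exp (-x)) := by
  have hr : 0 < √(d : ℝ) := Real.sqrt_pos.2 (by exact_mod_cast hd)
  have hs := Real.sqrt_nonneg x
  have hd2 := Real.sq_sqrt (Nat.cast_nonneg (α := ℝ) d)
  have hx2 := Real.sq_sqrt hx
  rw [Real.sqrt_mul (Nat.cast_nonneg d)]
  set r := √(d : ℝ)
  set s := √x
  have hrs : 0 < r + 2 * s := by linarith
  have ht : s / (r + 2 * s) < 1 / 2 := by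
    rw [div_lt_div_iff₀ hrs two_pos]
    linarith
  rw [← ofReal_measureReal]
  refine ENNReal.ofReal_le_ofReal
    ((pi_gaussianReal_real_le_sum_sq_le_exp (by positivity) ht _).trans_eq ?_)
  have h1 : 1 - 2 * (s / (r + 2 * s)) = r / (r + 2 * s) := by
    field_simp
    ring
  rw [h1, ← hd2, ← hx2]
  congr 1
  field_simp
  ring
end
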